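/- Let Ω be a nonempty bounded open subset of ℝ⁴ with Lebesgue measure |Ω|, let λ₁, λ₂ ∈ ℝ, μ₁, μ₂ > 0, θ₁, θ₂ < 0. Define A₁ as the set of parameter tuples with λ₁, λ₂ ∈ [0, λ₁(Ω)), and (min{λ₁(Ω)−λ₁, λ₁(Ω)−λ₂})²·S²/(λ₁(Ω)²·max{μ₁,μ₂}) + 2(θ₁+θ₂)|Ω| > 0; A₂ as the set with λ₁ ∈ [0, λ₁(Ω)), λ₂ ∈ ℝ, and (λ₁(Ω)−λ₁)²·S²/(λ₁(Ω)²·max{μ₁,μ₂}) + 2(θ₁+θ₂e^{−λ₂/θ₂})|Ω| > 0; A₃ as the set with λ₁, λ₂ ∈ ℝ and S²/max{μ₁,μ₂} + 2(θ₁e^{−λ₁/θ₁}+θ₂e^{−λ₂/θ₂})|Ω| > 0. Assume either: β < 0 and (λ₁,μ₁,θ₁;λ₂,μ₂,θ₂) belongs to A₁, A₂ or A₃; or β > 0 and there exists ε > 0 such that (λ₁,μ₁+βε,θ₁;λ₂,μ₂+β/ε,θ₂) belongs to A₁, A₂ or A₃. Then there exist δ > 0 and ρ > 0 such that ℒ(u,v)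 ≥ δ for all u, v ∈ C_c^∞(Ω) with (∫_Ω|∇u|² + ∫_Ω|∇v|²)^{1/2} = ρ. -/

import Mathlib

open MeasureTheory

noncomputable section

/-- The space `ℝ⁴`, with its Lebesgue measure. -/
abbrev E4 : Type := EuclideanSpace ℝ (Fin 4)

/-- `C_c^∞(Ω)`: smooth real-valued functions with compact support contained in `Ω`,
extended by zero to `ℝ⁴`. -/
def TestFun (Ω : Set E4) (u : E4 → ℝ) : Prop :=
  ContDiff ℝ (⊤ : ℕ∞) u ∧ HasCompactSupport u ∧ tsupport u ⊆ Ω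

/-- The positive part `u⁺ = max{u, 0}`. -/
def pp (u : E4 → ℝ) (x : E4) : ℝ := max (u x) 0

/-- The squared norm `|∇u|²` of the gradient. -/
def gradSq (u : E4 → ℝ) (x : E4) : ℝ := ‖fderiv ℝ u x‖ ^ 2

/-- The best Sobolev constant `S` of the embedding `D^{1,2}(ℝ⁴) ↪ L⁴(ℝ⁴)`. -/
def sobolevS : ℝ :=
  sInf { r : ℝ | ∃ w : E4 → ℝ, ContDiff ℝ (⊤ : ℕ∞) w ∧ HasCompactSupport w ∧ w ≠ 0 ∧
    r = (∫ x, gradSq w x) / (∫ x, (w x) ^ 4) ^ ((1 : ℝ) / 2) }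

/-- The first Dirichlet eigenvalue `λ₁(Ω)` of `−Δ` on `Ω`, as the infimum of the
Rayleigh quotient over test functions. -/
def lamOne (Ω : Set E4) : ℝ :=
  sInf { r : ℝ | ∃ w : E4 → ℝ, TestFun Ω w ∧ w ≠ 0 ∧
    r = (∫ x in Ω, gradSq w x) / (∫ x in Ω, (w x) ^ 2) }

/-- The modified energy functional `ℒ(u,v)` of the system. -/
def LL (Ω : Set E4) (lam1 mu1 th1 lam2 mu2 th2 β : ℝ) (u v : E4 → ℝ) : ℝ :=
  (1 / 2) * (∫ x in Ω, gradSq u x) - (lam1 / 2) * (∫ x in Ω, (pp u x) ^ 2)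
    - (mu1 / 4) * (∫ x in Ω, (pp u x) ^ 4)
    - (th1 / 2) * (∫ x in Ω, (pp u x) ^ 2 * (Real.log ((pp u x) ^ 2) - 1))
    + (1 / 2) * (∫ x in Ω, gradSq v x) - (lam2 / 2) * (∫ x in Ω, (pp v x) ^ 2)
    - (mu2 / 4) * (∫ x in Ω, (pp v x) ^ 4)
    - (th2 / 2) * (∫ x in Ω, (pp v x) ^ 2 * (Real.log ((pp v x) ^ 2) - 1))
    - (β / 2) * (∫ x in Ω, (pp u x) ^ 2 * (pp v x) ^ 2)

/-- The pairing `ℒ'(u,v)(u,v)` of the derivative of the energy with `(u,v)`. -/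
def LLp (Ω : Set E4) (lam1 mu1 th1 lam2 mu2 th2 β : ℝ) (u v : E4 → ℝ) : ℝ :=
  (∫ x in Ω, gradSq u x) + (∫ x in Ω, gradSq v x)
    - lam1 * (∫ x in Ω, (pp u x) ^ 2) - lam2 * (∫ x in Ω, (pp v x) ^ 2)
    - mu1 * (∫ x in Ω, (pp u x) ^ 4) - mu2 * (∫ x in Ω, (pp v x) ^ 4)
    - 2 * β * (∫ x in Ω, (pp u x) ^ 2 * (pp v x) ^ 2)
    - th1 * (∫ x in Ω, (pp u x) ^ 2 * Real.log ((pp u x) ^ 2))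
    - th2 * (∫ x in Ω, (pp v x) ^ 2 * Real.log ((pp v x) ^ 2))

/-- Membership of `(λ₁,μ₁,θ₁;λ₂,μ₂,θ₂)` in the set `A₁`. -/
def inA1 (Ω : Set E4) (lam1 mu1 th1 lam2 mu2 th2 : ℝ) : Prop :=
  0 ≤ lam1 ∧ lam1 < lamOne Ω ∧ 0 ≤ lam2 ∧ lam2 < lamOne Ω ∧
  0 < mu1 ∧ 0 < mu2 ∧ th1 < 0 ∧ th2 < 0 ∧
  (min (lamOne Ω - lam1) (lamOne Ω - lam2)) ^ 2 * sobolevS ^ 2 /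
      ((lamOne Ω) ^ 2 * max mu1 mu2) +
    2 * (th1 + th2) * (volume Ω).toReal > 0

/-- Membership of `(λ₁,μ₁,θ₁;λ₂,μ₂,θ₂)` in the set `A₂`. -/
def inA2 (Ω : Set E4) (lam1 mu1 th1 lam2 mu2 th2 : ℝ) : Prop :=
  0 ≤ lam1 ∧ lam1 < lamOne Ω ∧
  0 < mu1 ∧ 0 < mu2 ∧ th1 < 0 ∧ th2 < 0 ∧
  (lamOne Ω - lam1) ^ 2 * sobolevS ^ 2 / ((lamOne Ω) ^ 2 * max mu1 mu2) +
    2 * (th1 + th2 * Real.exp (-lam2 / th2)) * (volume Ω).toReal > 0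

/-- Membership of `(λ₁,μ₁,θ₁;λ₂,μ₂,θ₂)` in the set `A₃`. -/
def inA3 (Ω : Set E4) (lam1 mu1 th1 lam2 mu2 th2 : ℝ) : Prop :=
  0 < mu1 ∧ 0 < mu2 ∧ th1 < 0 ∧ th2 < 0 ∧
  sobolevS ^ 2 / max mu1 mu2 +
    2 * (th1 * Real.exp (-lam1 / th1) + th2 * Real.exp (-lam2 / th2)) *
      (volume Ω).toReal > 0

lemma h_gnn (Ω : Set E4) (w : E4 → ℝ) : 0 ≤ ∫ x in Ω, gradSq w x :=
  integral_nonneg fun x => by unfold gradSq; positivity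

lemma h_full {Ω : Set E4} {w : E4 → ℝ} (hw : TestFun Ω w) :
    (∫ x in Ω, gradSq w x) = ∫ x, gradSq w x := by
  apply setIntegral_eq_integral_of_forall_compl_eq_zero
  intro x hx
  have h1 : x ∉ tsupport (fderiv ℝ w) := fun h => hx (hw.2.2 (tsupport_fderiv_subset ℝ h))
  have h2 : fderiv ℝ w x = 0 := image_eq_zero_of_notMem_tsupport h1
  simp [gradSq, h2]

lemma h_Snn : 0 ≤ sobolevS := by
  apply Real.sInf_nonneg
  rintro r ⟨w, -, -, -, rfl⟩
  apply div_nonneg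
  · exact integral_nonneg fun x => by unfold gradSq; positivity
  · apply Real.rpow_nonneg
    exact integral_nonneg fun x => by positivity

lemma h_int {Ω : Set E4} {w : E4 → ℝ} (hw : TestFun Ω w) (f : ℝ → ℝ) (hf : Continuous f)
    (h0 : f 0 = 0) : Integrable (fun x => f (w x)) := by
  apply Continuous.integrable_of_hasCompactSupport
  · exact hf.comp hw.1.continuous
  · exact hw.2.1.comp_left h0

lemma h_sob {Ω : Set E4} {w : E4 → ℝ} (hw : TestFun Ω w) :
    sobolevS ^ 2 * (∫ x in Ω, (pp w x) ^ 4) ≤ (∫ x in Ω, gradSq w x) ^ 2 := by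
  have hi : Integrable (fun x => (w x) ^ 4) :=
    h_int hw (fun t => t ^ 4) (by fun_prop) (by simp)
  have hi2 : Integrable (fun x => (pp w x) ^ 4) :=
    h_int hw (fun t => (max t 0) ^ 4) (by fun_prop) (by simp)
  have h1 : (∫ x in Ω, (pp w x) ^ 4) ≤ ∫ x, (w x) ^ 4 := by
    refine (setIntegral_le_integral hi2 (Filter.Eventually.of_forall fun x => by
      simp only [Pi.zero_apply]; positivity)).trans ?_
    apply integral_mono hi2 hi
    intro x
    simp only [pp]
    rcases le_total (w x) 0 with h | h
    · rw [max_eq_right h]; simp; positivity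
    · rw [max_eq_left h]
  have h2 : sobolevS ^ 2 * (∫ x, (w x) ^ 4) ≤ (∫ x in Ω, gradSq w x) ^ 2 := by
    have hn : 0 ≤ ∫ x, (w x) ^ 4 := integral_nonneg fun x => by positivity
    rcases hn.eq_or_lt with h | h
    · rw [← h]; simp; positivity
    · have hne : w ≠ 0 := by
        rintro rfl
        simp at h
      have h3 : sobolevS ≤ (∫ x, gradSq w x) / (∫ x, (w x) ^ 4) ^ ((1 : ℝ) / 2) := by
        apply csInf_le
        · refine ⟨0, ?_⟩
          rintro r ⟨w, -, -, -, rfl⟩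
          apply div_nonneg
          · exact integral_nonneg fun x => by unfold gradSq; positivity
          · apply Real.rpow_nonneg
            exact integral_nonneg fun x => by positivity
        · exact ⟨w, hw.1, hw.2.1, hne, rfl⟩
      rw [← Real.sqrt_eq_rpow, le_div_iff₀ (Real.sqrt_pos.2 h)] at h3
      rw [h_full hw]
      have h4 := pow_le_pow_left₀ (mul_nonneg h_Snn (Real.sqrt_nonneg _)) h3 2
      rwa [mul_pow, Real.sq_sqrt hn] at h4
  exact (mul_le_mul_of_nonneg_left h1 (sq_nonneg _)).trans h2

lemma h_eig {Ω : Set E4} {w : E4 → ℝ} (hw : TestFun Ω w) (hL : 0 ≤ lamOne Ω) :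
    lamOne Ω * (∫ x in Ω, (pp w x) ^ 2) ≤ (∫ x in Ω, gradSq w x) := by
  have hi : Integrable (fun x => (w x) ^ 2) :=
    h_int hw (fun t => t ^ 2) (by fun_prop) (by simp)
  have hi2 : Integrable (fun x => (pp w x) ^ 2) :=
    h_int hw (fun t => (max t 0) ^ 2) (by fun_prop) (by simp)
  have h1 : (∫ x in Ω, (pp w x) ^ 2) ≤ ∫ x in Ω, (w x) ^ 2 := by
    apply integral_mono hi2.integrableOn hi.integrableOn
    intro x
    simp only [pp]
    rcases le_total (w x) 0 with h | h
    · rw [max_eq_right h]; simp; positivity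
    · rw [max_eq_left h]
  refine (mul_le_mul_of_nonneg_left h1 hL).trans ?_
  have hn : 0 ≤ ∫ x in Ω, (w x) ^ 2 := integral_nonneg fun x => by positivity
  rcases hn.eq_or_lt with h | h
  · rw [← h]; simp; exact h_gnn Ω w
  · have hne : w ≠ 0 := by
      rintro rfl
      simp at h
    rw [← le_div_iff₀ h]
    apply csInf_le
    · refine ⟨0, ?_⟩
      rintro r ⟨w, -, -, rfl⟩
      apply div_nonneg (h_gnn Ω w)
      exact integral_nonneg fun x => by positivity
    · exact ⟨w, hw, hne, rfl⟩

lemma h_pt (lam θ t : ℝ) (hθ : θ < 0) (ht : 0 ≤ t) :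
    θ * Real.exp (-lam / θ) ≤ -(lam * t) - θ * (t * (Real.log t - 1)) := by
  rcases ht.eq_or_lt with h | h
  · subst h
    have := Real.exp_pos (-lam / θ)
    simp; nlinarith
  · -- exp (-lam/θ - log t) ≥ 1 - lam/θ - log t
    have h1 := Real.add_one_le_exp (-lam / θ - Real.log t)
    rw [Real.exp_sub, Real.exp_log h, le_div_iff₀ h] at h1
    have h2 := mul_le_mul_of_nonpos_left h1 hθ.le
    refine h2.trans (le_of_eq ?_)
    have h3 : θ * (-lam / θ) = -lam := mul_div_cancel₀ _ hθ.ne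
    linear_combination t * h3

lemma h_log {Ω : Set E4} (hΩb : Bornology.IsBounded Ω) {w : E4 → ℝ}
    (hw : TestFun Ω w) (lam θ : ℝ) (hθ : θ < 0) :
    θ * Real.exp (-lam / θ) * (volume Ω).toReal ≤
      -(lam * ∫ x in Ω, (pp w x) ^ 2)
        - θ * (∫ x in Ω, (pp w x) ^ 2 * (Real.log ((pp w x) ^ 2) - 1)) := by
  have hi2 : Integrable (fun x => (pp w x) ^ 2) :=
    h_int hw (fun t => (max t 0) ^ 2) (by fun_prop) (by simp)
  have hi3 : Integrable (fun x => (pp w x) ^ 2 * (Real.log ((pp w x) ^ 2) - 1)) := by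
    refine h_int hw (fun t => (max t 0) ^ 2 * (Real.log ((max t 0) ^ 2) - 1)) ?_ (by simp)
    have hc : Continuous (fun t : ℝ => (max t 0) ^ 2 * Real.log ((max t 0) ^ 2) - (max t 0) ^ 2) :=
      (Real.continuous_mul_log.comp (by fun_prop : Continuous fun t : ℝ => (max t 0) ^ 2)).sub
        (by fun_prop)
    convert hc using 2
    ring
  have hi4 : Integrable (fun x => -(lam * (pp w x) ^ 2)) := (hi2.const_mul lam).neg
  rw [← integral_const_mul, ← integral_const_mul, ← integral_neg,
    ← integral_sub hi4.integrableOn (hi3.const_mul θ).integrableOn]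
  have hfin : volume Ω ≠ ⊤ := hΩb.measure_lt_top.ne
  have hcst : θ * Real.exp (-lam / θ) * (volume Ω).toReal
      = ∫ x in Ω, θ * Real.exp (-lam / θ) := by
    rw [setIntegral_const, smul_eq_mul, mul_comm]; rfl
  rw [hcst]
  apply integral_mono
  · exact integrableOn_const hfin
  · exact (hi4.sub (hi3.const_mul θ)).integrableOn
  · intro x
    exact h_pt lam θ _ hθ (sq_nonneg _)

lemma h_cross {Ω : Set E4} {u v : E4 → ℝ} (hu : TestFun Ω u) (hv : TestFun Ω v)
    (ε : ℝ) (hε : 0 < ε) :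
    2 * (∫ x in Ω, (pp u x) ^ 2 * (pp v x) ^ 2) ≤
      ε * (∫ x in Ω, (pp u x) ^ 4) + 1 / ε * (∫ x in Ω, (pp v x) ^ 4) := by
  have hi : Integrable (fun x => (pp u x) ^ 4) :=
    h_int hu (fun t => (max t 0) ^ 4) (by fun_prop) (by simp)
  have hi2 : Integrable (fun x => (pp v x) ^ 4) :=
    h_int hv (fun t => (max t 0) ^ 4) (by fun_prop) (by simp)
  rw [← integral_const_mul, ← integral_const_mul, ← integral_const_mul,
    ← integral_add (hi.const_mul _).integrableOn (hi2.const_mul _).integrableOn]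
  apply integral_mono_of_nonneg
  · exact Filter.Eventually.of_forall fun x => by simp only [Pi.zero_apply]; positivity
  · exact ((hi.const_mul _).add (hi2.const_mul _)).integrableOn
  · refine Filter.Eventually.of_forall fun x => ?_
    have : ε * pp u x ^ 4 + 1 / ε * pp v x ^ 4 - 2 * (pp u x ^ 2 * pp v x ^ 2)
      = 1 / ε * (ε * pp u x ^ 2 - pp v x ^ 2) ^ 2 := by
      field_simp
      ring
    have h2 : 0 ≤ 1 / ε * (ε * pp u x ^ 2 - pp v x ^ 2) ^ 2 := by positivity
    simp only
    linarith

/-- Single-component bound, small `lam`. -/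
lemma h_one {Ω : Set E4} (hΩb : Bornology.IsBounded Ω) {w : E4 → ℝ}
    (hw : TestFun Ω w) (lam θ m : ℝ) (hθ : θ < 0) (h0 : 0 ≤ lam) (h1 : lam < lamOne Ω)
    (hm : m ≤ (lamOne Ω - lam) / lamOne Ω) :
    m * (∫ x in Ω, gradSq w x) + θ * (volume Ω).toReal ≤
      (∫ x in Ω, gradSq w x) - lam * (∫ x in Ω, (pp w x) ^ 2)
        - θ * (∫ x in Ω, (pp w x) ^ 2 * (Real.log ((pp w x) ^ 2) - 1)) := by
  have hL : 0 < lamOne Ω := h0.trans_lt h1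
  have h2 := h_log hΩb hw 0 θ hθ
  simp only [neg_zero, zero_div, Real.exp_zero, mul_one, zero_mul, zero_sub] at h2
  have h3 := h_eig hw hL.le
  have h4 := mul_le_mul_of_nonneg_right hm (h_gnn Ω w)
  have h5 : lam * (∫ x in Ω, (pp w x) ^ 2) ≤ lam / lamOne Ω * (∫ x in Ω, gradSq w x) := by
    have := mul_le_mul_of_nonneg_left h3 (div_nonneg h0 hL.le)
    rwa [← mul_assoc, div_mul_cancel₀ _ hL.ne'] at this
  have h6 : (lamOne Ω - lam) / lamOne Ω = 1 - lam / lamOne Ω := by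
    field_simp
  rw [h6, sub_mul] at h4
  linarith

/-- Condition under which everything follows. -/
lemma h_params {Ω : Set E4} (hΩne : Ω.Nonempty) (hΩo : IsOpen Ω)
    (hΩb : Bornology.IsBounded Ω) (lam1 mu1 th1 lam2 mu2 th2 : ℝ)
    (h : inA1 Ω lam1 mu1 th1 lam2 mu2 th2 ∨ inA2 Ω lam1 mu1 th1 lam2 mu2 th2 ∨
      inA3 Ω lam1 mu1 th1 lam2 mu2 th2) :
    ∃ m c : ℝ, 0 < m ∧ 0 < sobolevS ∧ 0 < max mu1 mu2 ∧
      m ^ 2 * sobolevS ^ 2 / max mu1 mu2 + 2 * c * (volume Ω).toReal > 0 ∧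
      ∀ u v : E4 → ℝ, TestFun Ω u → TestFun Ω v →
        m * ((∫ x in Ω, gradSq u x) + (∫ x in Ω, gradSq v x)) + c * (volume Ω).toReal ≤
        ((∫ x in Ω, gradSq u x) - lam1 * (∫ x in Ω, (pp u x) ^ 2)
          - th1 * (∫ x in Ω, (pp u x) ^ 2 * (Real.log ((pp u x) ^ 2) - 1))) +
        ((∫ x in Ω, gradSq v x) - lam2 * (∫ x in Ω, (pp v x) ^ 2)
          - th2 * (∫ x in Ω, (pp v x) ^ 2 * (Real.log ((pp v x) ^ 2) - 1))) := by
  have hS : ∀ m M c : ℝ, c < 0 → m ^ 2 * sobolevS ^ 2 / M + 2 * c * (volume Ω).toReal > 0 →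
      0 < sobolevS := by
    intro m M c hc hh
    rcases h_Snn.eq_or_lt with h0 | h0
    · rw [← h0] at hh
      have : 0 ≤ (volume Ω).toReal := ENNReal.toReal_nonneg
      simp at hh
      nlinarith
    · exact h0
  rcases h with h | h | h
  · obtain ⟨a1, a2, b1, b2, m1, m2, t1, t2, hh⟩ := h
    have hL : 0 < lamOne Ω := a1.trans_lt a2
    have e : (min (lamOne Ω - lam1) (lamOne Ω - lam2) / lamOne Ω) ^ 2 * sobolevS ^ 2 / max mu1 mu2
        = (min (lamOne Ω - lam1) (lamOne Ω - lam2)) ^ 2 * sobolevS ^ 2 /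
          ((lamOne Ω) ^ 2 * max mu1 mu2) := by
      rw [div_pow, div_mul_eq_mul_div, div_div]
    rw [← e] at hh
    refine ⟨_, th1 + th2, ?_, hS _ _ _ (by linarith) hh, lt_max_of_lt_left m1, hh, ?_⟩
    · exact div_pos (lt_min (by linarith) (by linarith)) hL
    · intro u v hu hv
      have g1 := h_one hΩb hu lam1 th1 _ t1 a1 a2
        (div_le_div_of_nonneg_right (min_le_left (lamOne Ω - lam1) (lamOne Ω - lam2)) hL.le)
      have g2 := h_one hΩb hv lam2 th2 _ t2 b1 b2
        (div_le_div_of_nonneg_right (min_le_right (lamOne Ω - lam1) (lamOne Ω - lam2)) hL.le)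
      linarith
  · obtain ⟨a1, a2, m1, m2, t1, t2, hh⟩ := h
    have hL : 0 < lamOne Ω := a1.trans_lt a2
    have e : ((lamOne Ω - lam1) / lamOne Ω) ^ 2 * sobolevS ^ 2 / max mu1 mu2
        = (lamOne Ω - lam1) ^ 2 * sobolevS ^ 2 /
          ((lamOne Ω) ^ 2 * max mu1 mu2) := by
      rw [div_pow, div_mul_eq_mul_div, div_div]
    rw [← e] at hh
    have hx := mul_neg_of_neg_of_pos t2 (Real.exp_pos (-lam2 / th2))
    refine ⟨_, _, ?_, hS _ _ _ (by linarith) hh, lt_max_of_lt_left m1, hh, ?_⟩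
    · exact div_pos (by linarith) hL
    · intro u v hu hv
      have g1 := h_one hΩb hu lam1 th1 _ t1 a1 a2 le_rfl
      have g2 := h_log hΩb hv lam2 th2 t2
      have g3 : (lamOne Ω - lam1) / lamOne Ω ≤ 1 := by
        rw [div_le_one hL]; linarith
      have g4 := mul_le_mul_of_nonneg_right g3 (h_gnn Ω v)
      linarith
  · obtain ⟨m1, m2, t1, t2, hh⟩ := h
    have hx := mul_neg_of_neg_of_pos t2 (Real.exp_pos (-lam2 / th2))
    have hx' := mul_neg_of_neg_of_pos t1 (Real.exp_pos (-lam1 / th1))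
    have hh' : (1 : ℝ) ^ 2 * sobolevS ^ 2 / max mu1 mu2 +
      2 * (th1 * Real.exp (-lam1 / th1) + th2 * Real.exp (-lam2 / th2)) *
      (volume Ω).toReal > 0 := by rwa [one_pow, one_mul]
    refine ⟨1, _, one_pos, hS _ _ _ (by linarith) hh', lt_max_of_lt_left m1, hh', ?_⟩
    intro u v hu hv
    have g1 := h_log hΩb hu lam1 th1 t1
    have g2 := h_log hΩb hv lam2 th2 t2
    linarith

lemma h_main {Ω : Set E4} (hΩne : Ω.Nonempty) (hΩo : IsOpen Ω)
    (hΩb : Bornology.IsBounded Ω) (lam1 mu1 th1 lam2 mu2 th2 a1 a2 β : ℝ)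
    (h : inA1 Ω lam1 mu1 th1 lam2 mu2 th2 ∨ inA2 Ω lam1 mu1 th1 lam2 mu2 th2 ∨
      inA3 Ω lam1 mu1 th1 lam2 mu2 th2)
    (hab : ∀ u v : E4 → ℝ, TestFun Ω u → TestFun Ω v →
      a1 * (∫ x in Ω, (pp u x) ^ 4) + a2 * (∫ x in Ω, (pp v x) ^ 4)
        + 2 * β * (∫ x in Ω, (pp u x) ^ 2 * (pp v x) ^ 2) ≤
      mu1 * (∫ x in Ω, (pp u x) ^ 4) + mu2 * (∫ x in Ω, (pp v x) ^ 4)) :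
    ∃ δ ρ : ℝ, 0 < δ ∧ 0 < ρ ∧
      ∀ u v : E4 → ℝ, TestFun Ω u → TestFun Ω v →
        Real.sqrt ((∫ x in Ω, gradSq u x) + (∫ x in Ω, gradSq v x)) = ρ →
        LL Ω lam1 a1 th1 lam2 a2 th2 β u v ≥ δ := by
  obtain ⟨m, c, hm, hS, hM, hpos, H⟩ := h_params hΩne hΩo hΩb _ _ _ _ _ _ h
  set M := max mu1 mu2 with hMdef
  refine ⟨(m ^ 2 * sobolevS ^ 2 / M + 2 * c * (volume Ω).toReal) / 4,
    Real.sqrt (m * sobolevS ^ 2 / M), by linarith, Real.sqrt_pos.2 (by positivity), ?_⟩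
  intro u v hu hv hG
  have gu := h_gnn Ω u
  have gv := h_gnn Ω v
  rw [Real.sqrt_inj (by linarith) (by positivity)] at hG
  have k1 := H u v hu hv
  have k2 := hab u v hu hv
  have s1 := h_sob hu
  have s2 := h_sob hv
  have p1 : 0 ≤ ∫ x in Ω, (pp u x) ^ 4 := integral_nonneg fun x => by positivity
  have p2 : 0 ≤ ∫ x in Ω, (pp v x) ^ 4 := integral_nonneg fun x => by positivity
  have q1 := mul_le_mul_of_nonneg_right (le_max_left mu1 mu2) p1
  have q2 := mul_le_mul_of_nonneg_right (le_max_right mu1 mu2) p2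
  rw [← hMdef] at q1 q2
  unfold LL
  set Gu := ∫ x in Ω, gradSq u x
  set Gv := ∫ x in Ω, gradSq v x
  set P := ∫ x in Ω, (pp u x) ^ 4
  set Q := ∫ x in Ω, (pp v x) ^ 4
  have r1 : sobolevS ^ 2 * (P + Q) ≤ (m * sobolevS ^ 2 / M) ^ 2 := by
    rw [← hG]; nlinarith [mul_nonneg gu gv]
  have r2 : M * (P + Q) ≤ m ^ 2 * sobolevS ^ 2 / M := by
    have hk : 0 < M / sobolevS ^ 2 := by positivity
    have := mul_le_mul_of_nonneg_left r1 hk.le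
    have e1 : M / sobolevS ^ 2 * (sobolevS ^ 2 * (P + Q)) = M * (P + Q) := by
      field_simp
    have e2 : M / sobolevS ^ 2 * (m * sobolevS ^ 2 / M) ^ 2 = m ^ 2 * sobolevS ^ 2 / M := by
      field_simp
    rwa [e1, e2] at this
  have r3 : m * (Gu + Gv) = m ^ 2 * sobolevS ^ 2 / M := by rw [hG]; ring
  rw [r3] at k1
  linarith

/-- Lemma 4.1 of the paper: under the `A₁`/`A₂`/`A₃` conditions (for `β < 0`, resp. their
`ε`-shifted versions for `β > 0`), `ℒ ≥ δ > 0` on the sphere of radius `ρ`. -/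
theorem stmt_12 (Ω : Set E4) (hΩne : Ω.Nonempty) (hΩo : IsOpen Ω)
    (hΩb : Bornology.IsBounded Ω)
    (lam1 lam2 μ₁ μ₂ θ₁ θ₂ β : ℝ) (hμ₁ : 0 < μ₁) (hμ₂ : 0 < μ₂)
    (hθ₁ : θ₁ < 0) (hθ₂ : θ₂ < 0)
    (hcase :
      (β < 0 ∧ (inA1 Ω lam1 μ₁ θ₁ lam2 μ₂ θ₂ ∨ inA2 Ω lam1 μ₁ θ₁ lam2 μ₂ θ₂ ∨
        inA3 Ω lam1 μ₁ θ₁ lam2 μ₂ θ₂)) ∨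
      (0 < β ∧ ∃ ε : ℝ, 0 < ε ∧
        (inA1 Ω lam1 (μ₁ + β * ε) θ₁ lam2 (μ₂ + β / ε) θ₂ ∨
         inA2 Ω lam1 (μ₁ + β * ε) θ₁ lam2 (μ₂ + β / ε) θ₂ ∨
         inA3 Ω lam1 (μ₁ + β * ε) θ₁ lam2 (μ₂ + β / ε) θ₂))) :
    ∃ δ ρ : ℝ, 0 < δ ∧ 0 < ρ ∧
      ∀ u v : E4 → ℝ, TestFun Ω u → TestFun Ω v →
        Real.sqrt ((∫ x in Ω, gradSq u x) + (∫ x in Ω, gradSq v x)) = ρ →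
        LL Ω lam1 μ₁ θ₁ lam2 μ₂ θ₂ β u v ≥ δ := by
  rcases hcase with ⟨hβ, h⟩ | ⟨hβ, ε, hε, h⟩
  · refine h_main hΩne hΩo hΩb _ _ _ _ _ _ _ _ β h ?_
    intro u v hu hv
    have : 0 ≤ ∫ x in Ω, (pp u x) ^ 2 * (pp v x) ^ 2 := integral_nonneg fun x => by positivity
    nlinarith
  · refine h_main hΩne hΩo hΩb _ _ _ _ _ _ _ _ β h ?_
    intro u v hu hv
    have h1 := mul_le_mul_of_nonneg_left (h_cross hu hv ε hε) hβ.le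
    have h2 : β / ε = β * (1 / ε) := by ring
    rw [h2]
    linarith
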